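/- Let k > 0, σ > 0, and μ_y > 0. Then E[erf(kY)] > 0 for Y ∼ N(μ_y, σ²); explicitly, (1/(√(2π)σ)) ∫_ℝ erf(ky) · e^{−(y−μ_y)²/(2σ²)} dy > 0, where erf(z) = (2/√π)·∫₀ᶻ e^{−t²} dt. -/

import Mathlib

open MeasureTheory intervalIntegral

/-- The Gauss error function `erf z = (2/√π) ∫₀ᶻ e^{-t²} dt`. -/
noncomputable def erf (z : ℝ) : ℝ :=
  (2 / Real.sqrt Real.pi) * ∫ t in (0 : ℝ)..z, Real.exp (-t ^ 2)

lemma erf_neg_aux (z : ℝ) : erf (-z) = - erf z := by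
  unfold erf
  have h := intervalIntegral.integral_comp_neg (a := 0) (b := z)
    (fun t : ℝ => Real.exp (-t ^ 2))
  simp only [neg_zero, neg_sq] at h
  rw [h, intervalIntegral.integral_symm (-z) 0]
  ring

lemma erf_pos_aux {z : ℝ} (hz : 0 < z) : 0 < erf z := by
  unfold erf
  apply mul_pos
  · have := Real.pi_pos
    positivity
  · apply intervalIntegral.intervalIntegral_pos_of_pos
    · exact Continuous.intervalIntegrable (by fun_prop) _ _
    · intro x
      exact Real.exp_pos _
    · exact hz

lemma erf_continuous_aux : Continuous erf := by
  unfold erf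
  refine continuous_const.mul ?_
  exact intervalIntegral.continuous_primitive
    (fun a b => Continuous.intervalIntegrable (by fun_prop) _ _) 0

lemma erf_bounded_aux : ∃ C : ℝ, ∀ z, ‖erf z‖ ≤ C := by
  refine ⟨‖2 / Real.sqrt Real.pi‖ * ∫ t : ℝ, Real.exp (-t ^ 2), fun z => ?_⟩
  unfold erf
  rw [norm_mul]
  refine mul_le_mul_of_nonneg_left ?_ (norm_nonneg _)
  have hi : Integrable (fun t : ℝ => Real.exp (-t ^ 2)) := by
    simpa using integrable_exp_neg_mul_sq (b := 1) one_pos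
  refine (intervalIntegral.norm_integral_le_integral_norm_uIoc).trans ?_
  simp only [Real.norm_eq_abs, Real.abs_exp]
  exact setIntegral_le_integral hi (Filter.Eventually.of_forall fun t => (Real.exp_pos _).le)

/-- For `Y ∼ N(μ_y, σ²)` with `μ_y > 0` and `k > 0`, `E[erf(kY)] > 0`.
(Key positivity claim in the proof of Theorem 7.) -/
theorem expectation_erf_pos
    (k σ μy : ℝ) (hk : 0 < k) (hσ : 0 < σ) (hμ : 0 < μy) :
    0 < (Real.sqrt (2 * Real.pi) * σ)⁻¹ *
      ∫ y : ℝ, erf (k * y) * Real.exp (-(y - μy) ^ 2 / (2 * σ ^ 2)) := by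
  apply mul_pos
  · have := Real.pi_pos
    positivity
  set f : ℝ → ℝ := fun y => erf (k * y) * Real.exp (-(y - μy) ^ 2 / (2 * σ ^ 2)) with hf
  have hg : Integrable (fun y : ℝ => Real.exp (-(y - μy) ^ 2 / (2 * σ ^ 2))) := by
    have h := (integrable_exp_neg_mul_sq (b := 1 / (2 * σ ^ 2)) (by positivity)).comp_sub_right μy
    refine h.congr (Filter.Eventually.of_forall fun y => ?_)
    simp only
    congr 1
    ring
  have hfi : Integrable f := by
    obtain ⟨C, hC⟩ := erf_bounded_aux
    refine hg.bdd_mul (c := C) ?_ ?_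
    · exact (erf_continuous_aux.comp (by fun_prop : Continuous fun y : ℝ => k * y)).aestronglyMeasurable
    · exact Filter.Eventually.of_forall fun y => hC _
  have hfn : Integrable (fun y => f (-y)) := hfi.comp_neg
  have hpos : ∀ y, 0 < y → 0 < f y + f (-y) := by
    intro y hy
    have he : f y + f (-y) = erf (k * y) * (Real.exp (-(y - μy) ^ 2 / (2 * σ ^ 2))
        - Real.exp (-(-y - μy) ^ 2 / (2 * σ ^ 2))) := by
      simp only [hf, mul_neg, erf_neg_aux]
      ring
    rw [he]
    apply mul_pos (erf_pos_aux (mul_pos hk hy))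
    rw [sub_pos, Real.exp_lt_exp]
    apply div_lt_div_of_pos_right _ (by positivity)
    nlinarith [mul_pos hy hμ]
  have h0 : f 0 = 0 := by simp [hf, erf]
  have hnn : ∀ y, 0 ≤ f y + f (-y) := by
    intro y
    rcases lt_trichotomy y 0 with h | h | h
    · have := hpos (-y) (by linarith)
      rw [neg_neg] at this
      linarith
    · subst h
      simp [h0]
    · exact (hpos y h).le
  have hI : 0 < ∫ y, (f y + f (-y)) := by
    rw [integral_pos_iff_support_of_nonneg hnn (hfi.add hfn)]
    refine lt_of_lt_of_le ?_ (measure_mono (s := Set.Ioi (0 : ℝ)) ?_)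
    · simp
    · intro y hy
      exact (hpos y hy).ne'
  rw [integral_add hfi hfn, integral_neg_eq_self f volume] at hI
  linarith
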